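/- The subset M̃ = {x ∈ A : ∃ m ∈ M, φ(m) ≠ 0 and m⊗x ∈ M} is a unital subalgebra of A, and φ̃ restricted to M̃ is a K-algebra homomorphism from M̃ to K. -/

import Mathlib

theorem stmt_4_wd {K A : Type*} [Field K] [CommRing A] [Algebra K A]
    (M : Subalgebra K A) (χ : M →ₐ[K] K) (x : A) (a b a' b' : M)
    (ha : χ a ≠ 0) (ha' : χ a' ≠ 0) (hb : (b : A) = a * x) (hb' : (b' : A) = a' * x) :
    χ b / χ a = χ b' / χ a' := by
  rw [div_eq_div_iff ha ha', ← map_mul, ← map_mul]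
  congr 1
  apply Subtype.ext
  push_cast
  rw [hb, hb']; ring

theorem stmt_4_aux {K A : Type*} [Field K] [CommRing A] [Algebra K A]
    (M : Subalgebra K A) (χ : M →ₐ[K] K) :
    ∃ (N : Subalgebra K A) (ψ : N →ₐ[K] K),
      (∀ x, x ∈ N ↔ ∃ a b : M, χ a ≠ 0 ∧ (b : A) = a * x) ∧
      ∀ (x : A) (hx : x ∈ N) (a b : M), χ a ≠ 0 → (b : A) = a * x →
        ψ ⟨x, hx⟩ = χ b / χ a := by
  let N : Subalgebra K A :=
    { carrier := {x | ∃ a b : M, χ a ≠ 0 ∧ (b : A) = a * x}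
      mul_mem' := by
        rintro x y ⟨a, b, h, e⟩ ⟨a', b', h', e'⟩
        refine ⟨a * a', b * b', by simp [h, h'], ?_⟩
        push_cast; rw [e, e']; ring
      add_mem' := by
        rintro x y ⟨a, b, h, e⟩ ⟨a', b', h', e'⟩
        refine ⟨a * a', a' * b + a * b', by simp [h, h'], ?_⟩
        push_cast; rw [e, e']; ring
      algebraMap_mem' := fun r => ⟨1, algebraMap K M r, by simp, by simp⟩ }
  have hN : ∀ x : N, ∃ a b : M, χ a ≠ 0 ∧ (b : A) = a * x := fun x => x.2
  choose p q hp hq using hN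
  have key : ∀ (x : N) (a b : M), χ a ≠ 0 → (b : A) = a * x →
      χ (q x) / χ (p x) = χ b / χ a := fun x a b h e =>
    stmt_4_wd M χ x _ _ _ _ (hp x) h (hq x) e
  have halg : ∀ r : K, χ (q (algebraMap K N r)) / χ (p (algebraMap K N r)) = r := by
    intro r
    rw [key _ 1 (algebraMap K M r) (by simp) (by simp)]
    simp
  have hmul : ∀ x y : N, χ (q (x * y)) / χ (p (x * y))
      = χ (q x) / χ (p x) * (χ (q y) / χ (p y)) := by
    intro x y
    rw [key (x * y) (p x * p y) (q x * q y) (by simp [hp])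
      (by push_cast; rw [hq, hq]; ring), map_mul, map_mul, div_mul_div_comm]
  have hadd : ∀ x y : N, χ (q (x + y)) / χ (p (x + y))
      = χ (q x) / χ (p x) + (χ (q y) / χ (p y)) := by
    intro x y
    rw [key (x + y) (p x * p y) (q x * p y + p x * q y) (by simp [hp])
      (by push_cast; rw [hq, hq]; ring), map_mul, map_add, map_mul, map_mul,
      div_add_div _ _ (hp x) (hp y)]
  refine ⟨N, { toFun := fun x => χ (q x) / χ (p x)
               map_one' := by simpa using halg 1
               map_mul' := hmul
               map_zero' := by simpa using halg 0
               map_add' := hadd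
               commutes' := halg }, fun x => Iff.rfl, ?_⟩
  intro x hx a b h e
  exact key ⟨x, hx⟩ a b h e

/-- M̃ is a unital subalgebra of A and φ̃ restricted to M̃ is a K-algebra
    homomorphism M̃ → K. -/
theorem stmt_4 {K A : Type*} [Field K] [CommRing A] [Algebra K A]
    (M : Subalgebra K A) (F : Submodule K A)
    (hMF : ∀ m ∈ M, m ∈ F)
    (hstable : ∀ m ∈ M, ∀ u ∈ F, m * u ∈ F)
    (φ : F →ₗ[K] K)
    (hone : φ ⟨1, hMF 1 M.one_mem⟩ = 1)
    (hmul : ∀ (m u : A) (hm : m ∈ M) (hu : u ∈ F),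
      φ ⟨m * u, hstable m hm u hu⟩ = φ ⟨m, hMF m hm⟩ * φ ⟨u, hu⟩) :
    ∃ (N : Subalgebra K A) (ψ : N →ₐ[K] K),
      (N : Set A) = {x : A | ∃ a, ∃ ha : a ∈ M, φ ⟨a, hMF a ha⟩ ≠ 0 ∧ a * x ∈ M} ∧
      ∀ (x : A) (hx : x ∈ N) (a : A) (ha : a ∈ M)
          (_ : φ ⟨a, hMF a ha⟩ ≠ 0) (hax : a * x ∈ M),
        ψ ⟨x, hx⟩ = φ ⟨a * x, hMF _ hax⟩ / φ ⟨a, hMF a ha⟩ := by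


  let χ : M →ₐ[K] K := AlgHom.ofLinearMap
    (φ ∘ₗ Submodule.inclusion (p := Subalgebra.toSubmodule M) (p' := F) (fun m hm => hMF m hm))
    hone (fun x y => hmul x y x.2 (hMF _ y.2))
  have hχ : ∀ (a : A) (ha : a ∈ M), χ ⟨a, ha⟩ = φ ⟨a, hMF a ha⟩ := fun _ _ => rfl
  obtain ⟨N, ψ, h1, h2⟩ := stmt_4_aux M χ
  refine ⟨N, ψ, ?_, ?_⟩
  · ext x
    rw [SetLike.mem_coe, h1]
    constructor
    · rintro ⟨a, b, h, e⟩
      exact ⟨a, a.2, h, e ▸ b.2⟩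
    · rintro ⟨a, ha, h, e⟩
      exact ⟨⟨a, ha⟩, ⟨_, e⟩, h, rfl⟩
  · intro x hx a ha h hax
    exact h2 x hx ⟨a, ha⟩ ⟨_, hax⟩ h rfl
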